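/- Let c = ν₁ := −(1/6)√(5(13 + 5√7)), set u₁ := −(3/10)(c − √(c² − 10/3)) and t₁ := (1/6)(3 u₁² + 4 c u₁³ + 5 u₁⁴), and let q_c(u,v) = −(1/35)(5u³ + 6u²v + 8uv² + 16v³) − (c/315)(35u⁴ + 40u³v + 48u²v² + 64uv³ + 128v⁴) − (1/693)(63u⁵ + 70u⁴v + 80u³v² + 96u²v³ + 128uv⁴ + 256v⁵). Then there exists v < u₁ such that 6 t₁ + ∂_v q_c(u₁,v) + ∂_u q_c(u₁,v) = 0, ∂_v(∂_v q_c + ∂_u q_c)(u₁,v) = 0 and ∂_v²(∂_v q_c + ∂_u q_c)(u₁,v) < 0. That is, at c = ν₁ the second point of gradient catastrophe of the Burgers solution occurs exactly in correspondence of a trailing edge of the oscillatory zone. -/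

import Mathlib

/-- The polynomial q_c(u,v) of equation (4.6). -/
noncomputable def qc (c u v : ℝ) : ℝ :=
  -(1 / 35) * (5 * u ^ 3 + 6 * u ^ 2 * v + 8 * u * v ^ 2 + 16 * v ^ 3) -
    c / 315 * (35 * u ^ 4 + 40 * u ^ 3 * v + 48 * u ^ 2 * v ^ 2 + 64 * u * v ^ 3 +
      128 * v ^ 4) -
    1 / 693 * (63 * u ^ 5 + 70 * u ^ 4 * v + 80 * u ^ 3 * v ^ 2 + 96 * u ^ 2 * v ^ 3 +
      128 * u * v ^ 4 + 256 * v ^ 5)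

/-- The trailing-edge polynomial P(z) = 6t + ∂_v q_c(u,z) + ∂_u q_c(u,z). -/
noncomputable def Ptrail (c t u : ℝ) : ℝ → ℝ := fun z =>
  6 * t + deriv (fun b => qc c u b) z + deriv (fun a => qc c a z) u

/-- The leading-edge polynomial L(z) = 2t + ∂_u q_c(u,z). -/
noncomputable def Llead (c t u : ℝ) : ℝ → ℝ := fun z =>
  2 * t + deriv (fun a => qc c a z) u

/-- ν₁ = −(1/6)√(5(13 + 5√7)). -/
noncomputable def nu1 : ℝ := -(1 / 6) * Real.sqrt (5 * (13 + 5 * Real.sqrt 7))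

theorem Ptrail_eq (c t u z : ℝ) :
    Ptrail c t u z = 6 * t - 1 / 5 * (3 * u ^ 2 + 4 * u * z + 8 * z ^ 2) -
      4 * c / 35 * (5 * u ^ 3 + 6 * u ^ 2 * z + 8 * u * z ^ 2 + 16 * z ^ 3) -
      1 / 63 * (35 * u ^ 4 + 40 * u ^ 3 * z + 48 * u ^ 2 * z ^ 2 + 64 * u * z ^ 3 +
        128 * z ^ 4) := by
  have e (n : ℕ) (x : ℝ) : HasDerivAt (fun y : ℝ => y ^ n) (n * x ^ (n - 1)) x :=
    hasDerivAt_pow n x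
  have h₁ : HasDerivAt (fun b => qc c u b)
      (-(1 / 35) * (6 * u ^ 2 + 16 * u * z + 48 * z ^ 2) -
        c / 315 * (40 * u ^ 3 + 96 * u ^ 2 * z + 192 * u * z ^ 2 + 512 * z ^ 3) -
        1 / 693 * (70 * u ^ 4 + 160 * u ^ 3 * z + 288 * u ^ 2 * z ^ 2 + 512 * u * z ^ 3 +
          1280 * z ^ 4)) z := by
    unfold qc
    have i := hasDerivAt_id' z
    refine HasDerivAt.congr_deriv ((((((i.const_mul (6 * u ^ 2)).const_add (5 * u ^ 3)).add
      ((e 2 z).const_mul (8 * u))).add ((e 3 z).const_mul 16)).const_mul (-(1 / 35))).sub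
      ((((((i.const_mul (40 * u ^ 3)).const_add (35 * u ^ 4)).add
        ((e 2 z).const_mul (48 * u ^ 2))).add ((e 3 z).const_mul (64 * u))).add
        ((e 4 z).const_mul 128)).const_mul (c / 315)) |>.sub
      (((((((i.const_mul (70 * u ^ 4)).const_add (63 * u ^ 5)).add
        ((e 2 z).const_mul (80 * u ^ 3))).add ((e 3 z).const_mul (96 * u ^ 2))).add
        ((e 4 z).const_mul (128 * u))).add ((e 5 z).const_mul 256)).const_mul (1 / 693))) ?_
    norm_num
    ring
  have h₂ : HasDerivAt (fun a => qc c a z)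
      (-(1 / 35) * (15 * u ^ 2 + 12 * u * z + 8 * z ^ 2) -
        c / 315 * (140 * u ^ 3 + 120 * u ^ 2 * z + 96 * u * z ^ 2 + 64 * z ^ 3) -
        1 / 693 * (315 * u ^ 4 + 280 * u ^ 3 * z + 240 * u ^ 2 * z ^ 2 + 192 * u * z ^ 3 +
          128 * z ^ 4)) u := by
    unfold qc
    have i := hasDerivAt_id' u
    have m (n : ℕ) (k : ℝ) := ((e n u).const_mul k).mul_const
    refine HasDerivAt.congr_deriv (((((((e 3 u).const_mul 5).add (m 2 6 z)).add
      ((i.const_mul 8).mul_const (z ^ 2))).add_const (16 * z ^ 3)).const_mul (-(1 / 35))).sub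
      (((((((e 4 u).const_mul 35).add (m 3 40 z)).add (m 2 48 (z ^ 2))).add
        ((i.const_mul 64).mul_const (z ^ 3))).add_const (128 * z ^ 4)).const_mul (c / 315)) |>.sub
      ((((((((e 5 u).const_mul 63).add (m 4 70 z)).add (m 3 80 (z ^ 2))).add
        (m 2 96 (z ^ 3))).add ((i.const_mul 128).mul_const (z ^ 4))).add_const
        (256 * z ^ 5)).const_mul (1 / 693))) ?_
    norm_num
    ring
  simp only [Ptrail, h₁.deriv, h₂.deriv]
  ring

theorem hasDerivAt_double_quadratic (k a w z : ℝ) :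
    HasDerivAt (fun z : ℝ => k * ((z - a) * (z - w)) ^ 2)
      (2 * k * ((z - a) * (z - w) * (2 * z - a - w))) z := by
  refine HasDerivAt.congr_deriv (((((hasDerivAt_id' z).sub_const a).mul
    ((hasDerivAt_id' z).sub_const w)).pow 2).const_mul k) ?_
  norm_num
  ring

theorem hasDerivAt_deriv_double_quadratic (k a w : ℝ) :
    HasDerivAt (fun z : ℝ => 2 * k * ((z - a) * (z - w) * (2 * z - a - w)))
      (2 * k * (w - a) ^ 2) w := by
  have i := hasDerivAt_id' w
  refine HasDerivAt.congr_deriv ((((i.sub_const a).mul (i.sub_const w)).mul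
    (((i.const_mul 2).sub_const a).sub_const w)).const_mul (2 * k)) ?_
  simp only [Pi.mul_apply]
  ring

/-- With `r = √(3 (1 + √7) / 20)`, the value `ν₁` is rational in `r`. -/
theorem exists_parametrization_nu1 : ∃ r : ℝ, 0 < r ∧ r ^ 2 = 3 / 20 * (1 + √7) ∧
    nu1 = -((3 + 10 * r ^ 2) / (6 * r)) := by
  have hs : √7 ^ 2 = (7 : ℝ) := Real.sq_sqrt (by norm_num)
  have hs0 : 0 ≤ √(7 : ℝ) := Real.sqrt_nonneg 7
  refine ⟨√(3 / 20 * (1 + √7)), Real.sqrt_pos.2 (by positivity),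
    Real.sq_sqrt (by positivity), ?_⟩
  have hr : 0 < √(3 / 20 * (1 + √7)) := Real.sqrt_pos.2 (by positivity)
  have hr2 : √(3 / 20 * (1 + √7)) ^ 2 = 3 / 20 * (1 + √7) := Real.sq_sqrt (by positivity)
  generalize √(3 / 20 * (1 + √7)) = r at hr hr2
  have : √(5 * (13 + 5 * √7)) = (3 + 10 * r ^ 2) / r := by
    rw [Real.sqrt_eq_iff_eq_sq (by positivity) (by positivity), div_pow, hr2,
      eq_div_iff (by positivity)]
    linear_combination 3 / 2 * hs
  rw [nu1, this]
  field_simp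

/-- At c = ν₁ the second point of gradient catastrophe (u₁,t₁) of the Burgers solution
    occurs exactly in correspondence of a trailing edge: there is v < u₁ solving the
    trailing-edge system at (t₁,u₁). -/
theorem stmt16 (c : ℝ) (hc : c = nu1)
    (u₁ t₁ : ℝ) (hu : u₁ = -(3 / 10) * (c - Real.sqrt (c ^ 2 - 10 / 3)))
    (ht : t₁ = (1 / 6) * (3 * u₁ ^ 2 + 4 * c * u₁ ^ 3 + 5 * u₁ ^ 4)) :
    ∃ v : ℝ, v < u₁ ∧
      Ptrail c t₁ u₁ v = 0 ∧ deriv (Ptrail c t₁ u₁) v = 0 ∧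
      deriv (deriv (Ptrail c t₁ u₁)) v < 0 := by
  obtain ⟨r, hr, hr2, hν⟩ := exists_parametrization_nu1
  have hs : √7 ^ 2 = (7 : ℝ) := Real.sq_sqrt (by norm_num)
  have hs2 : 2 < √(7 : ℝ) := by
    rw [Real.lt_sqrt (by norm_num)]
    norm_num
  have hr4 : r ^ 4 = 3 / 10 * r ^ 2 + 27 / 200 := by
    have : r ^ 4 = (r ^ 2) ^ 2 := by ring
    rw [this, hr2]
    linear_combination 9 / 400 * hs
  have hcr : c = -((3 + 10 * r ^ 2) / (6 * r)) := hc.trans hν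
  have hD : √(c ^ 2 - 10 / 3) = (10 * r ^ 2 - 3) / (6 * r) := by
    have h0 : 0 ≤ (10 * r ^ 2 - 3) / (6 * r) := by
      apply div_nonneg _ (by positivity)
      rw [hr2]
      linarith
    rw [← Real.sqrt_sq h0, hcr]
    congr 1
    field_simp
    ring
  have hur : u₁ = r := by
    rw [hu, hD, hcr]
    field_simp
    ring
  subst hur
  set w := (9 - 20 * u₁ ^ 2) / (40 * u₁) with hw
  have hwu : w < u₁ := by
    rw [hw, div_lt_iff₀ (by positivity)]
    nlinarith
  have hP : Ptrail c t₁ u₁ = fun z => -(128 / 63) * ((z - u₁) * (z - w)) ^ 2 := by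
    funext z
    rw [Ptrail_eq, ht, hcr, hw]
    field_simp
    linear_combination -80640000 * (z - u₁) ^ 2 * hr4
  have hP' : deriv (Ptrail c t₁ u₁) =
      fun z => 2 * -(128 / 63) * ((z - u₁) * (z - w) * (2 * z - u₁ - w)) := by
    rw [hP]
    exact funext fun z => (hasDerivAt_double_quadratic _ _ _ z).deriv
  refine ⟨w, hwu, by simp [hP], by simp [hP'], ?_⟩
  rw [hP', (hasDerivAt_deriv_double_quadratic _ _ _).deriv]
  nlinarith [pow_pos (sub_pos.2 hwu) 2]
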